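/- For α > 0, the one-sided Fourier–Laplace transform of the Bessel function J₀ satisfies ∫₀^∞ e^{−(α + iy)t} J₀(t) dt = 1/√(1 + (α + iy)²) for all real y, where the square root is taken with positive real part. -/

import Mathlib

open MeasureTheory Set

/-- The Bessel function of the first kind of order 0, via its integral representation. -/
noncomputable def besselJ0 (t : ℝ) : ℝ :=
  (1 / Real.pi) * ∫ θ in (0:ℝ)..Real.pi, Real.cos (t * Real.sin θ)

/-- The Laplace transform of `cos (a t)` on the right half-plane. -/
lemma integral_exp_neg_mul_cos_Ioi {z : ℂ} (hz : 0 < z.re) (a : ℝ) :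
    ∫ t in Ioi (0:ℝ), Complex.exp (-z * t) * (Real.cos (t * a) : ℂ) = z / (z ^ 2 + a ^ 2) := by
  have h₁ : (-z + Complex.I * a).re < 0 := by simpa using hz
  have h₂ : (-z - Complex.I * a).re < 0 := by simpa using hz
  have h : ∀ t : ℝ, Complex.exp (-z * t) * (Real.cos (t * a) : ℂ) =
      (1 / 2) * (Complex.exp ((-z + Complex.I * a) * t) +
        Complex.exp ((-z - Complex.I * a) * t)) := by
    intro t
    rw [Complex.ofReal_cos, Complex.cos, sub_mul, add_mul, sub_eq_add_neg, Complex.exp_add,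
      Complex.exp_add]
    push_cast
    rw [show (t : ℂ) * a * Complex.I = Complex.I * a * t by ring,
      show -((t : ℂ) * a) * Complex.I = -(Complex.I * a * t) by ring]
    ring
  simp_rw [h]
  rw [integral_const_mul, integral_add (integrableOn_exp_mul_complex_Ioi h₁ 0)
    (integrableOn_exp_mul_complex_Ioi h₂ 0), integral_exp_mul_complex_Ioi h₁,
    integral_exp_mul_complex_Ioi h₂]
  have n₁ : -z + Complex.I * a ≠ 0 := fun h => by simp [h] at h₁
  have n₂ : -z - Complex.I * a ≠ 0 := fun h => by simp [h] at h₂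
  have e : z ^ 2 + (a : ℂ) ^ 2 = (-z + Complex.I * a) * (-z - Complex.I * a) := by
    linear_combination (a : ℂ) ^ 2 * Complex.I_sq
  rw [e]
  simp only [Complex.ofReal_zero, mul_zero, Complex.exp_zero]
  field_simp
  ring

lemma Complex.log_sub_log_neg_of_im_pos {u : ℂ} (hu : 0 < u.im) :
    Complex.log u - Complex.log (-u) = Real.pi * Complex.I := by
  simp only [Complex.log, norm_neg, Complex.arg_neg_eq_arg_sub_pi_of_im_pos hu]
  push_cast
  ring

lemma cos_add_I_mul_sin_mem_slitPlane {q : ℂ} (hq : 0 < q.re) {θ : ℝ}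
    (hθ : θ ∈ Icc (-(Real.pi / 2)) (Real.pi / 2)) :
    (Real.cos θ + Complex.I * q * Real.sin θ : ℂ) ∈ Complex.slitPlane := by
  rw [Complex.mem_slitPlane_iff]
  by_cases h : Real.sin θ = 0
  · left
    have hc := Real.cos_nonneg_of_mem_Icc hθ
    have : Real.cos θ ≠ 0 := fun h0 => by simpa [h, h0] using Real.sin_sq_add_cos_sq θ
    rw [h, Complex.ofReal_zero, mul_zero, add_zero, Complex.ofReal_re]
    positivity
  · right
    rw [Complex.add_im, Complex.ofReal_im, Complex.im_mul_ofReal]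
    simpa [hq.ne'] using h

lemma integral_div_sq_add_sin_sq {z w : ℂ} (hz : z ≠ 0) (hw : w ^ 2 = 1 + z ^ 2)
    (hwz : 0 < (w / z).re) :
    ∫ θ in (0:ℝ)..Real.pi, z / (z ^ 2 + (Real.sin θ : ℂ) ^ 2) = Real.pi / w := by
  set q := w / z with hq
  have hw0 : w ≠ 0 := by rintro rfl; simp [hq] at hwz
  have hwq : w = q * z := by rw [hq]; field_simp
  have hqz : q ^ 2 * z ^ 2 = 1 + z ^ 2 := by rw [← hw, hwq]; ring
  have hper : Function.Periodic (fun θ : ℝ => z / (z ^ 2 + (Real.sin θ : ℂ) ^ 2)) Real.pi := by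
    intro θ
    simp
  have hshift := hper.intervalIntegral_add_eq 0 (-(Real.pi / 2))
  rw [zero_add, show -(Real.pi / 2) + Real.pi = Real.pi / 2 by ring] at hshift
  rw [hshift]
  have hmem : ∀ θ ∈ Icc (-(Real.pi / 2)) (Real.pi / 2),
      (Real.cos θ + Complex.I * q * Real.sin θ : ℂ) ∈ Complex.slitPlane :=
    fun θ hθ => cos_add_I_mul_sin_mem_slitPlane hwz hθ
  have hmem' : ∀ θ ∈ Icc (-(Real.pi / 2)) (Real.pi / 2),
      (Real.cos θ - Complex.I * q * Real.sin θ : ℂ) ∈ Complex.slitPlane := by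
    intro θ hθ
    have := hmem (-θ) ⟨by linarith [hθ.2], by linarith [hθ.1]⟩
    rw [Real.cos_neg, Real.sin_neg] at this
    convert this using 1
    push_cast
    ring
  have hfac : ∀ θ : ℝ, z ^ 2 + (Real.sin θ : ℂ) ^ 2 =
      z ^ 2 * ((Real.cos θ + Complex.I * q * Real.sin θ) *
        (Real.cos θ - Complex.I * q * Real.sin θ)) := by
    intro θ
    have hcs : (Real.sin θ : ℂ) ^ 2 + (Real.cos θ : ℂ) ^ 2 = 1 := by
      exact_mod_cast Real.sin_sq_add_cos_sq θ
    linear_combination -z ^ 2 * hcs - (Real.sin θ : ℂ) ^ 2 * hqz +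
      z ^ 2 * q ^ 2 * (Real.sin θ : ℂ) ^ 2 * Complex.I_sq
  have hle : -(Real.pi / 2) ≤ Real.pi / 2 := by linarith [Real.pi_pos]
  have hderiv : ∀ θ ∈ uIcc (-(Real.pi / 2)) (Real.pi / 2),
      HasDerivAt (fun θ : ℝ => (1 / (2 * Complex.I * w)) *
        (Complex.log (Real.cos θ + Complex.I * q * Real.sin θ) -
          Complex.log (Real.cos θ - Complex.I * q * Real.sin θ)))
        (z / (z ^ 2 + (Real.sin θ : ℂ) ^ 2)) θ := by
    intro θ hθ
    rw [uIcc_of_le hle] at hθ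
    have hc := (Real.hasDerivAt_cos θ).ofReal_comp
    have hs := ((Real.hasDerivAt_sin θ).ofReal_comp).const_mul (Complex.I * q)
    have hd := (((hc.add hs).clog_real (hmem θ hθ)).sub
      ((hc.sub hs).clog_real (hmem' θ hθ))).const_mul (1 / (2 * Complex.I * w))
    refine hd.congr_deriv ?_
    have n₁ := Complex.slitPlane_ne_zero (hmem θ hθ)
    have n₂ := Complex.slitPlane_ne_zero (hmem' θ hθ)
    have hcs : (Real.sin θ : ℂ) ^ 2 + (Real.cos θ : ℂ) ^ 2 = 1 := by
      exact_mod_cast Real.sin_sq_add_cos_sq θ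
    simp only [Pi.add_apply, Pi.sub_apply]
    rw [hfac, div_sub_div _ _ n₁ n₂, hwq]
    have hq0 : q ≠ 0 := by rintro h; simp [h] at hwz
    rw [div_mul_div_comm, div_eq_div_iff (mul_ne_zero (by simp [hq0, hz]) (mul_ne_zero n₁ n₂))
      (mul_ne_zero (pow_ne_zero 2 hz) (mul_ne_zero n₁ n₂))]
    push_cast at hcs ⊢
    linear_combination 2 * Complex.I * q * z ^ 2 * (Complex.cos θ + Complex.I * q * Complex.sin θ) *
        (Complex.cos θ - Complex.I * q * Complex.sin θ) * hcs
  have hcont : ContinuousOn (fun θ : ℝ => z / (z ^ 2 + (Real.sin θ : ℂ) ^ 2))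
      (uIcc (-(Real.pi / 2)) (Real.pi / 2)) := by
    refine ContinuousOn.div continuousOn_const (by fun_prop) fun θ hθ => ?_
    rw [uIcc_of_le hle] at hθ
    rw [hfac]
    exact mul_ne_zero (pow_ne_zero 2 hz) (mul_ne_zero (Complex.slitPlane_ne_zero (hmem θ hθ))
      (Complex.slitPlane_ne_zero (hmem' θ hθ)))
  rw [intervalIntegral.integral_eq_sub_of_hasDerivAt hderiv hcont.intervalIntegrable]
  have hlog := Complex.log_sub_log_neg_of_im_pos (u := Complex.I * q) (by simpa using hwz)
  simp only [Real.cos_neg, Real.sin_neg, Real.cos_pi_div_two, Real.sin_pi_div_two,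
    Complex.ofReal_zero, Complex.ofReal_neg, Complex.ofReal_one, mul_one, zero_add, zero_sub,
    mul_neg, neg_neg]
  have hI := Complex.I_ne_zero
  field_simp
  linear_combination 2 * hlog

lemma integral_exp_neg_mul_besselJ0 {z : ℂ} (hz : 0 < z.re) :
    ∫ t in Ioi (0:ℝ), Complex.exp (-z * t) * (besselJ0 t : ℂ) =
      (1 / Real.pi) * ∫ θ in (0:ℝ)..Real.pi, z / (z ^ 2 + (Real.sin θ : ℂ) ^ 2) := by
  have h : ∀ t : ℝ, Complex.exp (-z * t) * (besselJ0 t : ℂ) = (1 / Real.pi) *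
      ∫ θ in Ioc 0 Real.pi, Complex.exp (-z * t) * (Real.cos (t * Real.sin θ) : ℂ) := by
    intro t
    rw [integral_const_mul, besselJ0, Complex.ofReal_mul, ← intervalIntegral.integral_ofReal,
      intervalIntegral.integral_of_le Real.pi_pos.le]
    push_cast
    ring
  simp_rw [h]
  rw [integral_const_mul, integral_integral_swap, intervalIntegral.integral_of_le Real.pi_pos.le]
  · simp_rw [integral_exp_neg_mul_cos_Ioi hz]
  · have hexp : IntegrableOn (fun t : ℝ => Complex.exp (-z * t)) (Ioi 0) :=
      integrableOn_exp_mul_complex_Ioi (by simpa using hz) 0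
    have hone : Integrable (fun _ : ℝ => (1 : ℂ)) (volume.restrict (Ioc 0 Real.pi)) :=
      integrable_const _
    refine (hexp.integrable.mul_prod hone).mono
      (Continuous.aestronglyMeasurable (by fun_prop)) (ae_of_all _ fun p => ?_)
    simp only [Function.uncurry, norm_mul, norm_one, Complex.norm_real]
    exact mul_le_mul_of_nonneg_left (Real.abs_cos_le_one _) (norm_nonneg _)

/-- If `w` and `z` lie in the right half-plane and `w ^ 2 = 1 + z ^ 2`, then `w` and `z` lie in the
same closed quadrant, so that `w / z` lies in the right half-plane. -/
lemma re_div_pos_of_sq_eq_one_add_sq {z w : ℂ} (hz : 0 < z.re) (hw : 0 < w.re)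
    (h : w ^ 2 = 1 + z ^ 2) : 0 < (w / z).re := by
  have him : w.re * w.im = z.re * z.im := by
    have := congrArg Complex.im h
    simp only [sq, Complex.add_im, Complex.mul_im, Complex.one_im] at this
    linarith
  have hnn : 0 ≤ w.im * z.im := by
    have : w.re * (w.im * z.im) = z.re * z.im ^ 2 := by linear_combination z.im * him
    have : 0 ≤ w.re * (w.im * z.im) := by rw [this]; positivity
    exact nonneg_of_mul_nonneg_right this hw
  have hns : 0 < Complex.normSq z := Complex.normSq_pos.2 fun h0 => by simp [h0] at hz
  rw [Complex.div_re, ← add_div]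
  exact div_pos (by linarith [mul_pos hw hz]) hns

lemma one_add_sq_mem_slitPlane {z : ℂ} (hz : 0 < z.re) : 1 + z ^ 2 ∈ Complex.slitPlane := by
  rw [Complex.mem_slitPlane_iff]
  by_cases h : z.im = 0
  · left
    simp only [sq, Complex.add_re, Complex.one_re, Complex.mul_re, h]
    nlinarith
  · right
    simp only [sq, Complex.add_im, Complex.one_im, Complex.mul_im, zero_add]
    rw [show z.re * z.im + z.im * z.re = 2 * z.re * z.im by ring]
    exact mul_ne_zero (by positivity) h

lemma Complex.cpow_half_re_pos {u : ℂ} (hu : u ∈ Complex.slitPlane) :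
    0 < (u ^ ((1 : ℂ) / 2)).re := by
  rw [Complex.cpow_def_of_ne_zero (Complex.slitPlane_ne_zero hu), Complex.exp_re]
  refine mul_pos (Real.exp_pos _) (Real.cos_pos_of_mem_Ioo ?_)
  have h : (Complex.log u * (1 / 2)).im = u.arg / 2 := by
    rw [show (1 / 2 : ℂ) = ((1 / 2 : ℝ) : ℂ) by push_cast; rfl, Complex.im_mul_ofReal,
      Complex.log_im]
    ring
  rw [h]
  have h₁ := Complex.neg_pi_lt_arg u
  have h₂ := (Complex.arg_le_pi u).lt_of_ne (Complex.slitPlane_arg_ne_pi hu)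
  constructor <;> linarith

theorem stmt_19 (α : ℝ) (hα : 0 < α) (y : ℝ) :
    (∫ t in Ioi (0:ℝ),
        Complex.exp (-((α : ℂ) + Complex.I * y) * t) * (besselJ0 t : ℂ))
      = 1 / ((1 + ((α : ℂ) + Complex.I * y) ^ 2) ^ ((1 : ℂ) / 2)) ∧
    0 < (((1 + ((α : ℂ) + Complex.I * y) ^ 2) ^ ((1 : ℂ) / 2)).re) := by
  have hz : 0 < ((α : ℂ) + Complex.I * y).re := by simpa using hα
  generalize (α : ℂ) + Complex.I * y = z at hz ⊢
  have hre := Complex.cpow_half_re_pos (one_add_sq_mem_slitPlane hz)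
  refine ⟨?_, hre⟩
  have hsq : ((1 + z ^ 2) ^ ((1 : ℂ) / 2)) ^ 2 = 1 + z ^ 2 := by
    rw [← Complex.cpow_nat_mul]
    norm_num
  have hz0 : z ≠ 0 := by rintro rfl; simp at hz
  have hpi : (Real.pi : ℂ) ≠ 0 := Complex.ofReal_ne_zero.2 Real.pi_ne_zero
  rw [integral_exp_neg_mul_besselJ0 hz,
    integral_div_sq_add_sin_sq hz0 hsq (re_div_pos_of_sq_eq_one_add_sq hz hre hsq)]
  field_simp
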